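/- arXiv:2511.03846 — 5 statements merged into one kernel-verified Lean document; each statement's English description precedes it below -/
import Mathlib

section
/- Let I_T be the constrained influence matrix built from unitaries (U_s)_{s∈S} and matrix ρ0. For m ≥ 1 define the off-diagonal projection Ĩ_m(s, s̄) = I_m(s, s̄) if s_m ≠ s̄_m and Ĩ_m(s, s̄) = 0 if s_m = s̄_m, and set Ĩ_0 = tr(ρ0). Then for every pair of trajectories (s, s̄) ∈ S^T × S^T one has the decomposition I_T(s, s̄) = Σ_{k=0}^{T} Ĩ_{T−k}((s₁,…,s_{T−k}),(s̄₁,…,s̄_{T−k})) · Π_{j=T−k+1}^{T} δ_{s_j, s̄_j}, and for each fixed (s, s̄) at most one summand on the right-hand side has a nonvanishing product of Kronecker deltas and indicator factors. -/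
open scoped Matrix

/-- The ordered product `U_{s_T} ⋯ U_{s_1}` of the conditioned unitaries along a
trajectory `s : Fin T → S`. -/
noncomputable def trajProd {N : ℕ} {S : Type*} (U : S → Matrix (Fin N) (Fin N) ℂ)
    {T : ℕ} (s : Fin T → S) : Matrix (Fin N) (Fin N) ℂ :=
  (List.ofFn fun j => U (s j)).reverse.prod

/-- The constrained influence matrix
`I_T(s, s̄) = tr( U_{s_T} ⋯ U_{s_1} ρ0 U_{s̄_1}† ⋯ U_{s̄_T}† )`; for `T = 0` this
reduces to `tr ρ0`. -/
noncomputable def IM {N : ℕ} {S : Type*} (U : S → Matrix (Fin N) (Fin N) ℂ)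
    (ρ0 : Matrix (Fin N) (Fin N) ℂ) {T : ℕ} (s sbar : Fin T → S) : ℂ :=
  (trajProd U s * ρ0 * (trajProd U sbar)ᴴ).trace

/-- The off-diagonal projection `Ĩ_m` of the influence matrix: `Ĩ_m(s, s̄)` is
`I_m(s, s̄)` if `s_m ≠ s̄_m` and `0` otherwise; by convention `Ĩ_0 = tr ρ0`. -/
noncomputable def ItildeIM {N : ℕ} {S : Type*} [DecidableEq S]
    (U : S → Matrix (Fin N) (Fin N) ℂ) (ρ0 : Matrix (Fin N) (Fin N) ℂ) :
    {m : ℕ} → (Fin m → S) → (Fin m → S) → ℂ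
  | 0, _, _ => ρ0.trace
  | (m + 1), s, sbar =>
      if s (Fin.last m) ≠ sbar (Fin.last m) then IM U ρ0 s sbar else 0

section Helpers

variable {N : ℕ} {S : Type*}

theorem trajProd_succ (U : S → Matrix (Fin N) (Fin N) ℂ) {T : ℕ} (s : Fin (T + 1) → S) :
    trajProd U s = U (s (Fin.last T)) * trajProd U (fun j : Fin T => s j.castSucc) := by
  unfold trajProd
  rw [List.ofFn_succ', List.concat_eq_append, List.reverse_append, List.prod_append]
  simp

/-- Unitarity removes the last time step when the two trajectories agree there. -/
theorem IM_succ_of_last_eq (U : S → Matrix (Fin N) (Fin N) ℂ)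
    (hU : ∀ a, U a ∈ Matrix.unitaryGroup (Fin N) ℂ) (ρ0 : Matrix (Fin N) (Fin N) ℂ)
    {T : ℕ} (s sbar : Fin (T + 1) → S) (h : s (Fin.last T) = sbar (Fin.last T)) :
    IM U ρ0 s sbar =
      IM U ρ0 (fun j : Fin T => s j.castSucc) (fun j : Fin T => sbar j.castSucc) := by
  have hu : (U (sbar (Fin.last T)))ᴴ * U (sbar (Fin.last T)) = 1 :=
    Matrix.mem_unitaryGroup_iff'.1 (hU _)
  unfold IM
  rw [trajProd_succ, trajProd_succ, h, Matrix.conjTranspose_mul, ← Matrix.mul_assoc,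
    Matrix.trace_mul_comm, ← Matrix.mul_assoc, ← Matrix.mul_assoc, ← Matrix.mul_assoc, hu,
    Matrix.one_mul]

variable [DecidableEq S]

/-- The contribution to the decomposition in which the trajectories agree from time `m` on. -/
noncomputable def decompTerm (U : S → Matrix (Fin N) (Fin N) ℂ) (ρ0 : Matrix (Fin N) (Fin N) ℂ)
    {T : ℕ} (s sbar : Fin T → S) (m : ℕ) (hm : m ≤ T) : ℂ :=
  ItildeIM U ρ0 (fun j : Fin m => s (Fin.castLE hm j)) (fun j : Fin m => sbar (Fin.castLE hm j)) *
    ∏ j ∈ Finset.univ.filter (fun j : Fin T => m ≤ (j : ℕ)), (if s j = sbar j then (1 : ℂ) else 0)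

theorem decompTerm_succ (U : S → Matrix (Fin N) (Fin N) ℂ) (ρ0 : Matrix (Fin N) (Fin N) ℂ)
    {T : ℕ} (s sbar : Fin (T + 1) → S) {m m' : ℕ} (hm' : m' ≤ T + 1) (hm : m ≤ T) (h : m' = m) :
    decompTerm U ρ0 s sbar m' hm' =
      decompTerm U ρ0 (fun j : Fin T => s j.castSucc) (fun j : Fin T => sbar j.castSucc) m hm *
        (if s (Fin.last T) = sbar (Fin.last T) then 1 else 0) := by
  subst h
  unfold decompTerm
  rw [Finset.prod_filter, Fin.prod_univ_castSucc, Finset.prod_filter, mul_assoc]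
  simp [hm]

theorem decompTerm_self_succ (U : S → Matrix (Fin N) (Fin N) ℂ) (ρ0 : Matrix (Fin N) (Fin N) ℂ)
    {T : ℕ} (s sbar : Fin (T + 1) → S) :
    decompTerm U ρ0 s sbar (T + 1) le_rfl =
      if s (Fin.last T) ≠ sbar (Fin.last T) then IM U ρ0 s sbar else 0 := by
  have hempty : Finset.univ.filter (fun j : Fin (T + 1) => T + 1 ≤ (j : ℕ)) = ∅ :=
    Finset.filter_false_of_mem fun j _ => by omega
  unfold decompTerm
  rw [hempty, Finset.prod_empty, mul_one]
  rfl

theorem IM_eq_sum_decompTerm (U : S → Matrix (Fin N) (Fin N) ℂ)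
    (hU : ∀ a, U a ∈ Matrix.unitaryGroup (Fin N) ℂ) (ρ0 : Matrix (Fin N) (Fin N) ℂ)
    (T : ℕ) (s sbar : Fin T → S) :
    IM U ρ0 s sbar =
      ∑ k ∈ Finset.range (T + 1), decompTerm U ρ0 s sbar (T - k) (Nat.sub_le T k) := by
  induction T with
  | zero => simp [IM, trajProd, decompTerm, ItildeIM]
  | succ T ih =>
    rw [Finset.sum_range_succ', Finset.sum_congr rfl fun k _ =>
      decompTerm_succ U ρ0 s sbar (Nat.sub_le (T + 1) (k + 1)) (Nat.sub_le T k) (by omega),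
      ← Finset.sum_mul, ← ih]
    refine Eq.trans ?_ (congrArg (_ + ·) (decompTerm_self_succ U ρ0 s sbar).symm)
    by_cases h : s (Fin.last T) = sbar (Fin.last T)
    · simp [h, IM_succ_of_last_eq U hU ρ0 s sbar h]
    · simp [h]

theorem eq_at_of_prod_deltas_ne_zero {T : ℕ} (s sbar : Fin T → S) {k k' : ℕ}
    (hk' : k' ≤ T) (hlt : k < k')
    (h : (∏ j ∈ Finset.univ.filter (fun j : Fin T => T - k' ≤ (j : ℕ)),
      (if s j = sbar j then (1 : ℂ) else 0)) ≠ 0) :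
    s ⟨T - k - 1, by omega⟩ = sbar ⟨T - k - 1, by omega⟩ := by
  by_contra hne
  refine h (Finset.prod_eq_zero (i := ⟨T - k - 1, by omega⟩) ?_ (if_neg hne))
  simp only [Finset.mem_filter, Finset.mem_univ, true_and]
  omega

end Helpers

/-- Decomposition of the constrained influence matrix:
`I_T(s, s̄) = Σ_{k=0}^{T} Ĩ_{T−k}((s₁,…,s_{T−k}),(s̄₁,…,s̄_{T−k})) ·
Π_{j=T−k+1}^{T} δ_{s_j, s̄_j}`, and for each fixed `(s, s̄)` at most one summand
has a nonvanishing product of Kronecker deltas and indicator factors. -/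
theorem IM_decomposition {N : ℕ} (hN : 1 ≤ N) {S : Type*} [Fintype S] [Nonempty S]
    [DecidableEq S]
    (U : S → Matrix (Fin N) (Fin N) ℂ)
    (hU : ∀ a, U a ∈ Matrix.unitaryGroup (Fin N) ℂ)
    (ρ0 : Matrix (Fin N) (Fin N) ℂ)
    (T : ℕ) (s sbar : Fin T → S) :
    (IM U ρ0 s sbar =
      ∑ k ∈ Finset.range (T + 1),
        ItildeIM U ρ0 (fun j : Fin (T - k) => s (Fin.castLE (Nat.sub_le T k) j))
            (fun j : Fin (T - k) => sbar (Fin.castLE (Nat.sub_le T k) j)) *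
          ∏ j ∈ Finset.univ.filter (fun j : Fin T => T - k ≤ (j : ℕ)),
            (if s j = sbar j then (1 : ℂ) else 0)) ∧
    (∀ k ∈ Finset.range (T + 1), ∀ k' ∈ Finset.range (T + 1),
      (∏ j ∈ Finset.univ.filter (fun j : Fin T => T - k ≤ (j : ℕ)),
            (if s j = sbar j then (1 : ℂ) else 0)) *
          (if h : T - k = 0 then 1
            else if s ⟨T - k - 1, by omega⟩ ≠ sbar ⟨T - k - 1, by omega⟩ then (1 : ℂ)
            else 0) ≠ 0 →
      (∏ j ∈ Finset.univ.filter (fun j : Fin T => T - k' ≤ (j : ℕ)),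
            (if s j = sbar j then (1 : ℂ) else 0)) *
          (if h : T - k' = 0 then 1
            else if s ⟨T - k' - 1, by omega⟩ ≠ sbar ⟨T - k' - 1, by omega⟩ then (1 : ℂ)
            else 0) ≠ 0 →
      k = k') := by
  refine ⟨IM_eq_sum_decompTerm U hU ρ0 T s sbar, fun k hk k' hk' h h' => ?_⟩
  rw [Finset.mem_range] at hk hk'
  rcases lt_trichotomy k k' with hlt | heq | hlt
  · have e := eq_at_of_prod_deltas_ne_zero s sbar (by omega) hlt (left_ne_zero_of_mul h')
    exact absurd (by rw [dif_neg (by omega), if_neg (not_not.2 e)]) (right_ne_zero_of_mul h)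
  · exact heq
  · have e := eq_at_of_prod_deltas_ne_zero s sbar (by omega) hlt (left_ne_zero_of_mul h)
    exact absurd (by rw [dif_neg (by omega), if_neg (not_not.2 e)]) (right_ne_zero_of_mul h')
end

section
/- Let k ≥ 1 and q ≥ 1 be integers and let σ and τ be permutations of {1,…,k}. Then the inner product of the associated permutation states equals q raised to the number of cycles of τ⁻¹σ: Σ over all pairs of functions s, s̄ : {1,…,k} → {1,…,q} of Π_{i=1}^{k} [s(τ(i)) = s̄(i)] · Π_{i=1}^{k} [s(σ(i)) = s̄(i)] = q^{c(τ⁻¹σ)}, where [P] equals 1 if P holds and 0 otherwise, and c(π) denotes the number of cycles of the permutation π, i.e., the number of orbits of π on {1,…,k} counting fixed points. -/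
/-- The number of cycles of a permutation `π` of a finite set: the number of
orbits of the cyclic group generated by `π`, counting fixed points. -/
noncomputable def cyclesCount {k : ℕ} (π : Equiv.Perm (Fin k)) : ℕ :=
  Nat.card (MulAction.orbitRel.Quotient (Subgroup.zpowers π) (Fin k))

/-- Functions invariant under a permutation `π` correspond to functions on the set of orbits of the
cyclic group generated by `π`. -/
def invariantFunctionsEquiv {α β : Type*} (π : Equiv.Perm α) :
    {f : α → β // ∀ i, f (π i) = f i} ≃
      (MulAction.orbitRel.Quotient (Subgroup.zpowers π) α → β) where
  toFun f := Quotient.lift f.1 <| by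
    rintro _ b ⟨⟨_, n, rfl⟩, rfl⟩
    have hinv : ∀ j, f.1 (π⁻¹ j) = f.1 j := fun j => by
      simpa using (f.2 (π⁻¹ j)).symm
    change f.1 ((π ^ n) b) = f.1 b
    induction n with
    | zero => simp
    | succ n ih => rw [add_comm, zpow_add, zpow_one, Equiv.Perm.mul_apply, f.2, ih]
    | pred n ih => rw [sub_eq_neg_add, zpow_add, zpow_neg_one, Equiv.Perm.mul_apply, hinv, ih]
  invFun g := ⟨fun i => g (Quotient.mk _ i), fun i => congrArg g <| Quotient.sound
    ⟨⟨π, Subgroup.mem_zpowers π⟩, rfl⟩⟩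
  left_inv _ := rfl
  right_inv g := funext fun x => Quotient.inductionOn x fun _ => rfl

theorem card_invariant_functions {k : ℕ} (q : ℕ) (π : Equiv.Perm (Fin k)) :
    Nat.card {f : Fin k → Fin q // ∀ i, f (π i) = f i} = q ^ cyclesCount π := by
  rw [Nat.card_congr (invariantFunctionsEquiv π), Nat.card_fun, Nat.card_fin, cyclesCount]

/-- The inner product of two permutation states equals `q` raised to the number
of cycles of `τ⁻¹σ`:
`Σ_{s, s̄ : Fin k → Fin q} Π_i [s(τ i) = s̄ i] · Π_i [s(σ i) = s̄ i] = q^{c(τ⁻¹σ)}`. -/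
theorem permutation_state_inner_product (k q : ℕ) (hk : 1 ≤ k) (hq : 1 ≤ q)
    (σ τ : Equiv.Perm (Fin k)) :
    (∑ s : Fin k → Fin q, ∑ sbar : Fin k → Fin q,
        (∏ i : Fin k, if s (τ i) = sbar i then (1 : ℕ) else 0) *
          ∏ i : Fin k, if s (σ i) = sbar i then (1 : ℕ) else 0) =
      q ^ cyclesCount (τ⁻¹ * σ) := by
  have hprod (s sbar : Fin k → Fin q) (ρ : Equiv.Perm (Fin k)) :
      (∏ i : Fin k, if s (ρ i) = sbar i then (1 : ℕ) else 0) =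
        if ∀ i, s (ρ i) = sbar i then 1 else 0 := by
    simp [Finset.prod_ite_zero]
  have hτ (s sbar : Fin k → Fin q) :
      (∀ i, s (τ i) = sbar i) ↔ s = fun i => sbar (τ⁻¹ i) := by
    rw [funext_iff, ← τ.forall_congr_right (q := fun j => s j = sbar (τ⁻¹ j))]
    simp
  rw [Finset.sum_comm, ← card_invariant_functions, Nat.card_eq_fintype_card, Fintype.card_subtype,
    Finset.card_filter]
  simp only [hprod, hτ, ite_mul, one_mul, zero_mul, Finset.sum_ite_eq', Finset.mem_univ, if_true,
    Equiv.Perm.mul_apply]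
  congr!
end

section
/- Let n be a real number with 0 < n < 1 and let C̃ > 0 be real. Suppose that for natural numbers p < T the weights w_j = C̃ · 2^{−(1−n) j} for j = p+1, …, T satisfy 0 < w_j ≤ 1, and set w₀ = 1 − Σ_{j=p+1}^{T} w_j, assumed to lie in [0,1]. Then the classical mixing entropy H = − Σ_{j=p+1}^{T} w_j log₂ w_j − w₀ log₂ w₀ (with the convention 0 · log₂ 0 = 0) satisfies H ≤ C̃ · ( |log₂ C̃| / (2^{1−n} − 1) + (1−n) · 2^{1−n} / (2^{1−n} − 1)² ) + 1/(e · ln 2); in particular H is bounded uniformly in T and p. -/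
/-- The function `-x log x` is at most `1 / e` on the nonnegative reals. -/
theorem negMulLog_le_inv_exp_one {x : ℝ} (hx : 0 ≤ x) :
    Real.negMulLog x ≤ 1 / Real.exp 1 := by
  rcases hx.eq_or_lt with rfl | hx
  · simpa using (Real.exp_pos 1).le
  · have he := Real.exp_pos 1
    have h := Real.log_le_sub_one_of_pos (inv_pos.2 (mul_pos he hx))
    rw [Real.log_inv, Real.log_mul he.ne' hx.ne', Real.log_exp] at h
    have h' : -Real.log x ≤ (Real.exp 1 * x)⁻¹ := by linarith
    calc Real.negMulLog x = x * -Real.log x := by rw [Real.negMulLog]; ring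
      _ ≤ x * (Real.exp 1 * x)⁻¹ := mul_le_mul_of_nonneg_left h' hx.le
      _ = 1 / Real.exp 1 := by field_simp

theorem neg_mul_logb_two_le {x : ℝ} (hx : 0 ≤ x) :
    -(x * Real.logb 2 x) ≤ 1 / (Real.exp 1 * Real.log 2) := by
  have h2 : 0 < Real.log 2 := Real.log_pos one_lt_two
  calc -(x * Real.logb 2 x) = Real.negMulLog x / Real.log 2 := by
        rw [Real.negMulLog, Real.logb]; ring
    _ ≤ 1 / Real.exp 1 / Real.log 2 :=
        div_le_div_of_nonneg_right (negMulLog_le_inv_exp_one hx) h2.le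
    _ = 1 / (Real.exp 1 * Real.log 2) := div_div _ _ _

/-- A finite sum of positive powers of `a⁻¹` is at most the full series `1 / (a - 1)`. -/
theorem sum_inv_pow_le {a : ℝ} (ha : 1 < a) {s : Finset ℕ} (hs : 0 ∉ s) :
    ∑ j ∈ s, a⁻¹ ^ j ≤ 1 / (a - 1) := by
  have ha0 : 0 < a := by linarith
  have hr0 : 0 ≤ a⁻¹ := inv_nonneg.2 ha0.le
  have h := sum_le_hasSum (insert 0 s) (fun j _ => pow_nonneg hr0 j)
    (hasSum_geometric_of_lt_one hr0 (inv_lt_one_of_one_lt₀ ha))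
  rw [Finset.sum_insert hs, pow_zero] at h
  have ha1 : a - 1 ≠ 0 := by linarith
  have e : (1 - a⁻¹)⁻¹ = 1 + 1 / (a - 1) := by
    have : 1 - a⁻¹ = (a - 1) / a := by field_simp
    rw [this]; field_simp; ring
  linarith

/-- A finite sum of terms `j * a⁻¹ ^ j` is at most the full series `a / (a - 1) ^ 2`. -/
theorem sum_mul_inv_pow_le {a : ℝ} (ha : 1 < a) (s : Finset ℕ) :
    ∑ j ∈ s, (j : ℝ) * a⁻¹ ^ j ≤ a / (a - 1) ^ 2 := by
  have ha0 : 0 < a := by linarith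
  have hr0 : 0 ≤ a⁻¹ := inv_nonneg.2 ha0.le
  have h := sum_le_hasSum s (fun j _ => mul_nonneg (Nat.cast_nonneg j) (pow_nonneg hr0 j))
    (hasSum_coe_mul_geometric_of_norm_lt_one
      (by rw [Real.norm_of_nonneg hr0]; exact inv_lt_one_of_one_lt₀ ha))
  have ha1 : a - 1 ≠ 0 := by linarith
  have e : a⁻¹ / (1 - a⁻¹) ^ 2 = a / (a - 1) ^ 2 := by
    have : 1 - a⁻¹ = (a - 1) / a := by field_simp
    rw [this]; field_simp
  rwa [e] at h


/-- Bound on the classical mixing entropy of the coarse-grained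
influence-matrix decomposition weights `w_j = C̃ · 2^{−(1−n)j}`,
`j = p+1, …, T`, together with `w₀ = 1 − Σ_j w_j`:
`H = − Σ_j w_j log₂ w_j − w₀ log₂ w₀` is bounded by
`C̃ (|log₂ C̃|/(2^{1−n}−1) + (1−n)·2^{1−n}/(2^{1−n}−1)²) + 1/(e·ln 2)`,
uniformly in `T` and `p`. -/
theorem classical_mixing_entropy_bound
    (n C : ℝ) (hn0 : 0 < n) (hn1 : n < 1) (hC : 0 < C)
    (p T : ℕ) (hpT : p < T)
    (hw : ∀ j ∈ Finset.Icc (p + 1) T,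
      0 < C * (2 : ℝ) ^ (-(1 - n) * j) ∧ C * (2 : ℝ) ^ (-(1 - n) * j) ≤ 1)
    (hw0 : 0 ≤ 1 - ∑ j ∈ Finset.Icc (p + 1) T, C * (2 : ℝ) ^ (-(1 - n) * j) ∧
      1 - ∑ j ∈ Finset.Icc (p + 1) T, C * (2 : ℝ) ^ (-(1 - n) * j) ≤ 1) :
    (-(∑ j ∈ Finset.Icc (p + 1) T,
          C * (2 : ℝ) ^ (-(1 - n) * j) *
            Real.logb 2 (C * (2 : ℝ) ^ (-(1 - n) * j))) -
        (1 - ∑ j ∈ Finset.Icc (p + 1) T, C * (2 : ℝ) ^ (-(1 - n) * j)) *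
          Real.logb 2
            (1 - ∑ j ∈ Finset.Icc (p + 1) T, C * (2 : ℝ) ^ (-(1 - n) * j))) ≤
      C * (|Real.logb 2 C| / ((2 : ℝ) ^ (1 - n) - 1) +
            (1 - n) * (2 : ℝ) ^ (1 - n) / ((2 : ℝ) ^ (1 - n) - 1) ^ 2) +
        1 / (Real.exp 1 * Real.log 2) := by
  have ha : 1 < (2 : ℝ) ^ (1 - n) := Real.one_lt_rpow one_lt_two (by linarith)
  have hpow (j : ℕ) : (2 : ℝ) ^ (-(1 - n) * j) = ((2 : ℝ) ^ (1 - n))⁻¹ ^ j := by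
    rw [Real.rpow_mul zero_le_two, Real.rpow_neg zero_le_two, Real.rpow_natCast]
  have hlog (j : ℕ) : Real.logb 2 (C * (2 : ℝ) ^ (-(1 - n) * j)) =
      Real.logb 2 C - (1 - n) * j := by
    rw [Real.logb_mul hC.ne' (by positivity), Real.logb_rpow two_pos (by norm_num)]
    ring
  have hlast := neg_mul_logb_two_le hw0.1
  have hgeom := sum_inv_pow_le ha (s := Finset.Icc (p + 1) T) (by simp)
  have harith := sum_mul_inv_pow_le ha (Finset.Icc (p + 1) T)
  have hmain : -(∑ j ∈ Finset.Icc (p + 1) T, C * (2 : ℝ) ^ (-(1 - n) * j) *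
        Real.logb 2 (C * (2 : ℝ) ^ (-(1 - n) * j))) ≤
      C * (|Real.logb 2 C| / ((2 : ℝ) ^ (1 - n) - 1) +
        (1 - n) * (2 : ℝ) ^ (1 - n) / ((2 : ℝ) ^ (1 - n) - 1) ^ 2) := by
    simp only [hlog]
    simp only [hpow]
    set a := (2 : ℝ) ^ (1 - n)
    calc -(∑ j ∈ Finset.Icc (p + 1) T, C * a⁻¹ ^ j * (Real.logb 2 C - (1 - n) * j))
        = C * (-Real.logb 2 C * ∑ j ∈ Finset.Icc (p + 1) T, a⁻¹ ^ j +
            (1 - n) * ∑ j ∈ Finset.Icc (p + 1) T, (j : ℝ) * a⁻¹ ^ j) := by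
          simp only [Finset.mul_sum, ← Finset.sum_add_distrib, ← Finset.sum_neg_distrib]
          exact Finset.sum_congr rfl fun j _ => by ring
      _ ≤ C * (|Real.logb 2 C| * (1 / (a - 1)) + (1 - n) * (a / (a - 1) ^ 2)) := by
          have hn : 0 ≤ 1 - n := by linarith
          gcongr
          exact neg_le_abs _
      _ = _ := by ring
  linarith
end

section
/- Fix an integer d ≥ 2 and a real number r > 0, and for real D > 1 define ε(D, r) = 2 D^{3(r−1)} + ( (3/4) r log_d D + 2 ) D^{2(r−1)} + 2 D^{r−1} and S(D) = − log_d [ (1 + D^{4(r−1)} + ε(D, r)) / (1 + D^{2r−1})² ]. Then, as D → ∞: (i) if r < 1/2, then S(D) → 0; (ii) if 1/2 < r ≤ 1, then S(D) / log_d D → 2(2r−1); (iii) if r > 1, then S(D) / log_d D → 2. -/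
open Filter

/-- The correction term `ε(D, r)` of the asymptotic Rényi-2 temporal
entanglement formula. -/
noncomputable def epsTerm (d : ℕ) (r D : ℝ) : ℝ :=
  2 * D ^ (3 * (r - 1)) +
    ((3 / 4) * r * Real.logb d D + 2) * D ^ (2 * (r - 1)) +
    2 * D ^ (r - 1)

/-- The asymptotic Rényi-2 temporal entanglement
`S(D) = − log_d [ (1 + D^{4(r−1)} + ε(D, r)) / (1 + D^{2r−1})² ]`. -/
noncomputable def renyiTE (d : ℕ) (r D : ℝ) : ℝ :=
  -Real.logb d ((1 + D ^ (4 * (r - 1)) + epsTerm d r D) / (1 + D ^ (2 * r - 1)) ^ 2)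

/-- A function squeezed between `D ^ a` and `K * log_b D * D ^ a` grows like `D ^ a` on the
logarithmic scale. -/
theorem tendsto_logb_div_logb_of_rpow_bounds {b : ℝ} (hb : 1 < b) {f : ℝ → ℝ} {a K : ℝ}
    (hK : 0 < K) (hlower : ∀ᶠ D in atTop, D ^ a ≤ f D)
    (hupper : ∀ᶠ D in atTop, f D ≤ K * Real.logb b D * D ^ a) :
    Tendsto (fun D => Real.logb b (f D) / Real.logb b D) atTop (nhds a) := by
  have hL := Real.tendsto_logb_atTop hb
  have hlogb : Tendsto (fun y => Real.logb b y / y) atTop (nhds 0) := by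
    have h := (Real.isLittleO_log_id_atTop.tendsto_div_nhds_zero).div_const (Real.log b)
    rw [zero_div] at h
    refine h.congr fun y => ?_
    simp only [Real.logb, id]
    ring
  have hbound : Tendsto (fun D => Real.logb b K / Real.logb b D +
      Real.logb b (Real.logb b D) / Real.logb b D + a) atTop (nhds a) := by
    simpa using ((tendsto_const_nhds.div_atTop hL).add (hlogb.comp hL)).add_const a
  refine tendsto_of_tendsto_of_tendsto_of_le_of_le' tendsto_const_nhds hbound ?_ ?_
  · filter_upwards [hlower, hL.eventually_ge_atTop 1, eventually_gt_atTop 0] with D h h1 h0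
    rw [le_div_iff₀ (by linarith), ← Real.logb_rpow_eq_mul_logb_of_pos h0]
    exact Real.logb_le_logb_of_le hb (Real.rpow_pos_of_pos h0 a) h
  · filter_upwards [hlower, hupper, hL.eventually_ge_atTop 1, eventually_gt_atTop 0]
      with D h h' h1 h0
    have hpow := Real.rpow_pos_of_pos h0 a
    have hlog := Real.logb_le_logb_of_le hb (hpow.trans_le h) h'
    rw [Real.logb_mul (by positivity) hpow.ne', Real.logb_mul hK.ne' (by positivity),
      Real.logb_rpow_eq_mul_logb_of_pos h0] at hlog
    rw [div_le_iff₀ (by linarith), add_mul, add_mul, div_mul_cancel₀ _ (by positivity),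
      div_mul_cancel₀ _ (by positivity)]
    exact hlog

/-- The numerator in `renyiTE` has logarithmic growth exponent `max 0 (4 * (r - 1))`. -/
theorem tendsto_logb_numerator_div_logb {d : ℕ} (hd : 2 ≤ d) {r : ℝ} (hr : 0 < r) :
    Tendsto (fun D : ℝ => Real.logb d (1 + D ^ (4 * (r - 1)) + epsTerm d r D) / Real.logb d D)
      atTop (nhds (max 0 (4 * (r - 1)))) := by
  have hb : (1 : ℝ) < d := by exact_mod_cast hd
  have hL := Real.tendsto_logb_atTop hb
  refine tendsto_logb_div_logb_of_rpow_bounds hb (K := 8 + 3 / 4 * r) (by positivity) ?_ ?_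
  · filter_upwards [hL.eventually_ge_atTop 1, eventually_ge_atTop 1] with D hD1 hD
    have h0 : 0 < D := by linarith
    have heps : 0 ≤ epsTerm d r D := by unfold epsTerm; positivity
    rcases max_choice 0 (4 * (r - 1)) with h | h <;> rw [h]
    · have := Real.rpow_pos_of_pos h0 (4 * (r - 1))
      rw [Real.rpow_zero]
      linarith
    · linarith
  · filter_upwards [hL.eventually_ge_atTop 1, eventually_ge_atTop 1] with D hD1 hD
    set M := max 0 (4 * (r - 1)) with hM
    have hM0 : 0 ≤ M := le_max_left _ _
    have hM4 : 4 * (r - 1) ≤ M := le_max_right _ _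
    have key : ∀ x, x ≤ M → D ^ x ≤ D ^ M := fun x hx =>
      Real.rpow_le_rpow_of_exponent_le hD hx
    have h0 := key 0 hM0
    rw [Real.rpow_zero] at h0
    have h1 := key (r - 1) (by linarith)
    have h2 := mul_le_mul_of_nonneg_left (key (2 * (r - 1)) (by linarith))
      (show 0 ≤ 3 / 4 * r * Real.logb d D + 2 by positivity)
    have h3 := key (3 * (r - 1)) (by linarith)
    have h4 := key (4 * (r - 1)) hM4
    have h5 : D ^ M ≤ Real.logb d D * D ^ M := le_mul_of_one_le_left (by linarith) hD1
    unfold epsTerm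
    linarith

/-- The limit of `renyiTE` relative to `log_d D` when the denominator grows. -/
theorem tendsto_renyiTE_div_logb {d : ℕ} (hd : 2 ≤ d) {r : ℝ} (hr : 1 / 2 < r) :
    Tendsto (fun D : ℝ => renyiTE d r D / Real.logb d D) atTop
      (nhds (2 * (2 * r - 1) - max 0 (4 * (r - 1)))) := by
  have hb : (1 : ℝ) < d := by exact_mod_cast hd
  have hL := Real.tendsto_logb_atTop hb
  have hden : Tendsto (fun D : ℝ => Real.logb d (1 + D ^ (2 * r - 1)) / Real.logb d D)
      atTop (nhds (2 * r - 1)) := by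
    refine tendsto_logb_div_logb_of_rpow_bounds hb (K := 2) two_pos
      (Eventually.of_forall fun D => by linarith) ?_
    filter_upwards [hL.eventually_ge_atTop 1, eventually_ge_atTop 1] with D hD1 hD
    have h1 : 1 ≤ D ^ (2 * r - 1) := Real.one_le_rpow hD (by linarith)
    have h2 := le_mul_of_one_le_left (by linarith : 0 ≤ D ^ (2 * r - 1)) hD1
    linarith
  refine ((hden.const_mul 2).sub
    (tendsto_logb_numerator_div_logb hd (by linarith : 0 < r))).congr' ?_
  filter_upwards [hL.eventually_ge_atTop 1, eventually_ge_atTop 1] with D hD1 hD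
  have h0 : 0 < D := by linarith
  have hr0 : 0 < r := by linarith
  have heps : 0 ≤ epsTerm d r D := by unfold epsTerm; positivity
  rw [renyiTE, Real.logb_div (by positivity) (by positivity), Real.logb_pow]
  push_cast
  ring

/-- Below `r = 1 / 2` the Rényi-2 temporal entanglement vanishes asymptotically. -/
theorem tendsto_renyiTE_zero (d : ℕ) {r : ℝ} (hr : r < 1 / 2) :
    Tendsto (fun D : ℝ => renyiTE d r D) atTop (nhds 0) := by
  have hpow : ∀ x : ℝ, x < 0 → Tendsto (fun D : ℝ => D ^ x) atTop (nhds 0) := fun x hx => by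
    simpa using tendsto_rpow_neg_atTop (neg_pos.2 hx)
  have hlog : Tendsto (fun D : ℝ => Real.logb d D * D ^ (2 * (r - 1))) atTop (nhds 0) := by
    have h := ((isLittleO_log_rpow_atTop (by linarith : 0 < -(2 * (r - 1)))).tendsto_div_nhds_zero
      ).div_const (Real.log d)
    rw [zero_div] at h
    refine h.congr' ?_
    filter_upwards [eventually_gt_atTop 0] with D hD
    rw [Real.rpow_neg hD.le, Real.logb, div_inv_eq_mul]
    ring
  have heps : Tendsto (fun D : ℝ => epsTerm d r D) atTop (nhds 0) := by
    have h := ((((hpow (3 * (r - 1)) (by linarith)).const_mul 2).add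
      (hlog.const_mul (3 / 4 * r))).add ((hpow (2 * (r - 1)) (by linarith)).const_mul 2)).add
      ((hpow (r - 1) (by linarith)).const_mul 2)
    simp only [mul_zero, add_zero] at h
    refine h.congr fun D => ?_
    unfold epsTerm
    ring
  have hquot := (((hpow (4 * (r - 1)) (by linarith)).const_add 1).add heps).div
    (((hpow (2 * r - 1) (by linarith)).const_add 1).pow 2) (by norm_num)
  norm_num at hquot
  have h := ((hquot.log one_ne_zero).div_const (Real.log d)).neg
  simpa [renyiTE, Real.logb] using h

/-- Asymptotics of the Rényi-2 temporal entanglement of the structureless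
random-unitary bath model as the bath dimension `D → ∞`:
(i) for `r < 1/2`, `S(D) → 0`;
(ii) for `1/2 < r ≤ 1`, `S(D)/log_d D → 2(2r−1)`;
(iii) for `r > 1`, `S(D)/log_d D → 2`. -/
theorem renyiTE_asymptotics (d : ℕ) (hd : 2 ≤ d) (r : ℝ) (hr : 0 < r) :
    (r < 1 / 2 → Tendsto (fun D : ℝ => renyiTE d r D) atTop (nhds 0)) ∧
    (1 / 2 < r → r ≤ 1 →
      Tendsto (fun D : ℝ => renyiTE d r D / Real.logb d D) atTop
        (nhds (2 * (2 * r - 1)))) ∧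
    (1 < r →
      Tendsto (fun D : ℝ => renyiTE d r D / Real.logb d D) atTop (nhds 2)) := by
  refine ⟨tendsto_renyiTE_zero d, fun h1 h2 => ?_, fun h1 => ?_⟩
  · simpa [max_eq_left (by linarith : 4 * (r - 1) ≤ 0)] using tendsto_renyiTE_div_logb hd h1
  · have h := tendsto_renyiTE_div_logb hd (by linarith : 1 / 2 < r)
    rw [max_eq_right (by linarith)] at h
    convert h using 2
    ring
end

section
/- Let ρ_I be the influence-matrix state built from T independent Haar-random unitaries on ℂ^d ⊗ ℂ^D with maximally mixed initial bath state ρ_B = 𝟙_D / D. Then the Haar-expected purity satisfies E[ tr(ρ_I²) ] ≤ d^{−2T} + 1/D². -/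
open MeasureTheory
open scoped Matrix

noncomputable instance matrixMeasurableSpace (n : Type*) [Fintype n] :
    MeasurableSpace (Matrix n n ℂ) := borel _

instance matrixBorelSpace (n : Type*) [Fintype n] :
    BorelSpace (Matrix n n ℂ) := ⟨rfl⟩

/-- The `D × D` block `⟨s|U|q⟩` of an operator `U` on `ℂ^d ⊗ ℂ^D`. -/
def blockM {d D : ℕ} (U : Matrix (Fin d × Fin D) (Fin d × Fin D) ℂ)
    (s q : Fin d) : Matrix (Fin D) (Fin D) ℂ :=
  fun a b => U (s, a) (q, b)

/-- The influence-matrix state built from unitaries `u 0, …, u (T-1)` on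
`ℂ^d ⊗ ℂ^D` and initial bath state `ρB`: the `d^{2T} × d^{2T}` matrix with
entries
`ρ_I[(q₁,s₁,…),(q̄₁,s̄₁,…)] = d^{−T} tr((U_T)^{s_T}_{q_T} ⋯ (U₁)^{s₁}_{q₁} ρB
((U₁)^{s̄₁}_{q̄₁})† ⋯ ((U_T)^{s̄_T}_{q̄_T})†)`.  A temporal index is a function
`Fin T → Fin d × Fin d`, assigning to each time step the pair `(q_τ, s_τ)`. -/
noncomputable def influenceState {d D : ℕ} {T : ℕ}
    (u : Fin T → Matrix.unitaryGroup (Fin d × Fin D) ℂ)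
    (ρB : Matrix (Fin D) (Fin D) ℂ) :
    Matrix (Fin T → Fin d × Fin d) (Fin T → Fin d × Fin d) ℂ :=
  fun qs qsbar =>
    ((d : ℂ) ^ T)⁻¹ *
      ((List.ofFn fun τ =>
            blockM ((u τ : Matrix (Fin d × Fin D) (Fin d × Fin D) ℂ))
              (qs τ).2 (qs τ).1).reverse.prod *
        ρB *
        ((List.ofFn fun τ =>
            blockM ((u τ : Matrix (Fin d × Fin D) (Fin d × Fin D) ℂ))
              (qsbar τ).2 (qsbar τ).1).reverse.prod)ᴴ).trace

open scoped Kronecker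

section Commutant

variable {ι : Type*} [Fintype ι] [DecidableEq ι]

theorem phase_mem_unitaryGroup (j : ι) :
    (Matrix.diagonal fun x => if x = j then Complex.I else 1) ∈ Matrix.unitaryGroup ι ℂ := by
  rw [Matrix.mem_unitaryGroup_iff, Matrix.star_eq_conjTranspose, Matrix.diagonal_conjTranspose,
    Matrix.diagonal_mul_diagonal, ← Matrix.diagonal_one]
  congr 1
  funext x
  by_cases h : x = j <;> simp [h]

theorem perm_mem_unitaryGroup (σ : Equiv.Perm ι) :
    (1 : Matrix ι ι ℂ).submatrix σ id ∈ Matrix.unitaryGroup ι ℂ := by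
  rw [Matrix.mem_unitaryGroup_iff, Matrix.star_eq_conjTranspose, Matrix.conjTranspose_submatrix,
    Matrix.conjTranspose_one]
  ext a b
  simp [Matrix.mul_apply, Matrix.one_apply, eq_comm]

theorem rotation_mem_unitaryGroup (i j : ι) :
    (3 / 5 : ℂ) • (1 : Matrix ι ι ℂ) +
      (4 / 5 * Complex.I) • (1 : Matrix ι ι ℂ).submatrix (Equiv.swap i j) id ∈
      Matrix.unitaryGroup ι ℂ := by
  have hS : (1 : Matrix ι ι ℂ).submatrix (Equiv.swap i j) id *
      (1 : Matrix ι ι ℂ).submatrix (Equiv.swap i j) id = 1 := by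
    ext a b
    simp only [Matrix.mul_apply, Matrix.submatrix_apply, Matrix.one_apply, id, ite_mul, one_mul,
      zero_mul, Finset.sum_ite_eq, Finset.mem_univ, if_true, Equiv.swap_apply_self]
  have hSH : ((1 : Matrix ι ι ℂ).submatrix (Equiv.swap i j) id)ᴴ =
      (1 : Matrix ι ι ℂ).submatrix (Equiv.swap i j) id := by
    rw [Matrix.conjTranspose_submatrix, Matrix.conjTranspose_one]
    ext a b
    simp only [Matrix.submatrix_apply, Matrix.one_apply, id]
    congr 1
    rw [eq_iff_iff, ← Equiv.swap_apply_eq_iff, eq_comm]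
  rw [Matrix.mem_unitaryGroup_iff, Matrix.star_eq_conjTranspose, Matrix.conjTranspose_add,
    Matrix.conjTranspose_smul, Matrix.conjTranspose_smul, hSH]
  simp only [Matrix.conjTranspose_one, add_mul, mul_add, smul_mul_smul_comm, hS, one_mul, mul_one]
  ext a b
  simp only [Matrix.add_apply, Matrix.smul_apply, smul_eq_mul]
  simp
  linear_combination (-16 / 25 * (1 : Matrix ι ι ℂ) a b) * Complex.I_mul_I

variable {M : Matrix (ι × ι) (ι × ι) ℂ}

theorem apply_eq_zero_of_commute
    (h : ∀ V ∈ Matrix.unitaryGroup ι ℂ, (V ⊗ₖ V) * M = M * (V ⊗ₖ V)) {i k r s : ι}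
    (h₁ : ¬(i = r ∧ k = s)) (h₂ : ¬(i = s ∧ k = r)) : M (i, k) (r, s) = 0 := by
  by_contra hne
  have key : ∀ j : ι, ((if i = j then Complex.I else 1) * (if k = j then Complex.I else 1) : ℂ) =
      (if r = j then Complex.I else 1) * (if s = j then Complex.I else 1) := by
    intro j
    have := congrFun (congrFun (h _ (phase_mem_unitaryGroup j)) (i, k)) (r, s)
    rw [Matrix.diagonal_kronecker_diagonal, Matrix.diagonal_mul, Matrix.mul_diagonal,
      mul_comm] at this
    exact mul_left_cancel₀ hne this
  have hi := key i
  have hk := key k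
  have e₁ : Complex.I ≠ 1 := fun e => by simpa using congrArg Complex.re e
  have e₂ : (-1 : ℂ) ≠ Complex.I := fun e => by simpa using congrArg Complex.re e
  have e₃ : (-1 : ℂ) ≠ 1 := by norm_num
  have e₄ := Complex.I_mul_I
  grind

theorem apply_perm_of_commute
    (h : ∀ V ∈ Matrix.unitaryGroup ι ℂ, (V ⊗ₖ V) * M = M * (V ⊗ₖ V)) (σ : Equiv.Perm ι)
    (i k r s : ι) : M (σ i, σ k) (σ r, σ s) = M (i, k) (r, s) := by
  have := congrFun (congrFun (h _ (perm_mem_unitaryGroup σ)) (i, k)) (σ r, σ s)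
  simpa [Matrix.mul_apply, Fintype.sum_prod_type, Matrix.one_apply, ite_and] using this

theorem apply_diag_of_commute
    (h : ∀ V ∈ Matrix.unitaryGroup ι ℂ, (V ⊗ₖ V) * M = M * (V ⊗ₖ V)) {i j : ι} (hij : i ≠ j) :
    M (i, i) (i, i) = M (i, j) (i, j) + M (j, i) (i, j) := by
  have := congrFun (congrFun (h _ (rotation_mem_unitaryGroup i j)) (i, i)) (i, j)
  have z₁ : M (i, i) (i, j) = 0 := apply_eq_zero_of_commute h (by simp [hij]) (by simp [hij])
  have z₂ : M (j, j) (i, j) = 0 :=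
    apply_eq_zero_of_commute h (by simp [hij.symm]) (by simp [hij.symm])
  have z₃ : M (i, i) (j, i) = 0 := apply_eq_zero_of_commute h (by simp [hij]) (by simp [hij])
  have z₄ : M (i, i) (j, j) = 0 := apply_eq_zero_of_commute h (by simp [hij]) (by simp [hij])
  have hsw : ∀ x y : ι, (Equiv.swap i j x = y) = (x = Equiv.swap i j y) := fun x y => by
    rw [Equiv.swap_apply_eq_iff]
  simp [Matrix.mul_apply, Fintype.sum_prod_type, Matrix.one_apply, add_mul, mul_add,
    Finset.sum_add_distrib, hsw, z₁, z₂, z₃, z₄] at this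
  linear_combination (25 / 12 * Complex.I) * this -
    (M (j, i) (i, j) + M (i, j) (i, j) - M (i, i) (i, i)) * Complex.I_mul_I

/-- A matrix commuting with all `V ⊗ V` is a combination of the identity and the swap. -/
theorem exists_eq_add_swap_of_commute [Nontrivial ι]
    (h : ∀ V ∈ Matrix.unitaryGroup ι ℂ, (V ⊗ₖ V) * M = M * (V ⊗ₖ V)) :
    ∃ a b : ℂ, ∀ p q, M p q = (if p = q then a else 0) + (if p = q.swap then b else 0) := by
  obtain ⟨i₀, j₀, h₀⟩ := exists_pair_ne ι
  have tr : ∀ {i j : ι}, i ≠ j → ∃ σ : Equiv.Perm ι, σ i₀ = i ∧ σ j₀ = j := fun hij =>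
    MulAction.is_two_pretransitive_iff.1
      (Equiv.Perm.isMultiplyPretransitive ι 2) h₀ hij
  have ha : ∀ {i j : ι}, i ≠ j → M (i, j) (i, j) = M (i₀, j₀) (i₀, j₀) := by
    intro i j hij
    obtain ⟨σ, rfl, rfl⟩ := tr hij
    exact apply_perm_of_commute h σ _ _ _ _
  have hb : ∀ {i j : ι}, i ≠ j → M (i, j) (j, i) = M (i₀, j₀) (j₀, i₀) := by
    intro i j hij
    obtain ⟨σ, rfl, rfl⟩ := tr hij
    exact apply_perm_of_commute h σ _ _ _ _
  refine ⟨M (i₀, j₀) (i₀, j₀), M (i₀, j₀) (j₀, i₀), ?_⟩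
  rintro ⟨i, k⟩ ⟨r, s⟩
  simp only [Prod.mk.injEq, Prod.swap_prod_mk]
  by_cases h₁ : i = r ∧ k = s
  · obtain ⟨rfl, rfl⟩ := h₁
    by_cases hik : i = k
    · subst hik
      obtain ⟨j, hj⟩ := exists_ne i
      simp [apply_diag_of_commute h hj.symm, ha hj.symm, hb hj]
    · simp [hik, ha hik]
  · by_cases h₂ : i = s ∧ k = r
    · obtain ⟨rfl, rfl⟩ := h₂
      have hik : i ≠ k := fun e => h₁ ⟨e, e.symm⟩
      simp [hik, hb hik]
    · simp [h₁, h₂, apply_eq_zero_of_commute h h₁ h₂]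

end Commutant

section Twirl

variable {ι : Type*} [Fintype ι]

theorem integrable_of_continuous {X : Type*} [TopologicalSpace X] [CompactSpace X]
    [MeasurableSpace X] [OpensMeasurableSpace X] {μ : Measure X} [IsFiniteMeasure μ]
    {f : X → ℂ} (hf : Continuous f) : Integrable f μ :=
  hf.integrable_of_hasCompactSupport (HasCompactSupport.of_compactSpace f)

theorem integral_mul_mul_apply {X : Type*} [MeasurableSpace X] {μ : Measure X}
    {F : X → Matrix ι ι ℂ} (hF : ∀ i j, Integrable (fun x => F x i j) μ) (A B : Matrix ι ι ℂ)
    (i j : ι) :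
    ∫ x, (A * F x * B) i j ∂μ = (A * (Matrix.of fun k l => ∫ x, F x k l ∂μ) * B) i j := by
  simp only [Matrix.mul_apply, Matrix.of_apply]
  rw [integral_finsetSum]
  · refine Finset.sum_congr rfl fun l _ => ?_
    rw [integral_mul_const, integral_finsetSum]
    · simp only [integral_const_mul]
    · exact fun k _ => (hF k l).const_mul _
  · exact fun l _ => (integrable_finsetSum _ fun k _ => (hF k l).const_mul _).mul_const _

/-- The pairing of a matrix on two replicas with the swap. -/
def swapTrace (X : Matrix (ι × ι) (ι × ι) ℂ) : ℂ := ∑ p, X p p.swap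

theorem swapTrace_eq_trace (X : Matrix (ι × ι) (ι × ι) ℂ) :
    swapTrace X = (X.submatrix id Prod.swap).trace := rfl

variable [DecidableEq ι]

instance : SecondCountableTopology (Matrix.unitaryGroup ι ℂ) :=
  haveI : SecondCountableTopology (Matrix ι ι ℂ) :=
    inferInstanceAs (SecondCountableTopology (ι → ι → ℂ))
  TopologicalSpace.Subtype.secondCountableTopology (Matrix.unitaryGroup ι ℂ : Set (Matrix ι ι ℂ))

instance : CompactSpace (Matrix.unitaryGroup ι ℂ) := by
  have hK : IsCompact (Set.univ.pi fun _ => Set.univ.pi fun _ => Metric.closedBall 0 1 :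
      Set (ι → ι → ℂ)) :=
    isCompact_univ_pi fun _ => isCompact_univ_pi fun _ => isCompact_closedBall 0 1
  refine isCompact_iff_compactSpace.1 (IsCompact.of_isClosed_subset (X := Matrix ι ι ℂ) hK ?_ ?_)
  · have : (Matrix.unitaryGroup ι ℂ : Set (Matrix ι ι ℂ)) = {A | A * star A = 1} := by
      ext A
      exact Matrix.mem_unitaryGroup_iff
    rw [this]
    exact isClosed_eq (by fun_prop) continuous_const
  · intro U hU i _ j _
    simpa using entry_norm_bound_of_unitary hU i j

/-- Conjugation of a matrix on two replicas by `U ⊗ U`. -/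
def replicaConj (X : Matrix (ι × ι) (ι × ι) ℂ) (U : Matrix ι ι ℂ) :
    Matrix (ι × ι) (ι × ι) ℂ :=
  (U ⊗ₖ U) * X * (U ⊗ₖ U)ᴴ

theorem continuous_replicaConj (X : Matrix (ι × ι) (ι × ι) ℂ) :
    Continuous fun U : Matrix.unitaryGroup ι ℂ => replicaConj X (U : Matrix ι ι ℂ) := by
  have : Continuous fun U : Matrix.unitaryGroup ι ℂ =>
      ((U : Matrix ι ι ℂ) ⊗ₖ (U : Matrix ι ι ℂ)) := by
    refine continuous_matrix fun p q => ?_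
    simp only [Matrix.kroneckerMap_apply]
    exact (continuous_subtype_val.matrix_elem _ _).mul (continuous_subtype_val.matrix_elem _ _)
  unfold replicaConj
  fun_prop

theorem integrable_replicaConj_apply (X : Matrix (ι × ι) (ι × ι) ℂ)
    (μ : Measure (Matrix.unitaryGroup ι ℂ)) [IsFiniteMeasure μ] (p q : ι × ι) :
    Integrable (fun U : Matrix.unitaryGroup ι ℂ => replicaConj X (U : Matrix ι ι ℂ) p q) μ :=
  integrable_of_continuous ((continuous_replicaConj X).matrix_elem p q)

theorem kronecker_conjTranspose_mul_self {U : Matrix ι ι ℂ} (hU : U ∈ Matrix.unitaryGroup ι ℂ) :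
    (U ⊗ₖ U)ᴴ * (U ⊗ₖ U) = 1 := by
  rw [Matrix.conjTranspose_kronecker, ← Matrix.mul_kronecker_mul, ← Matrix.star_eq_conjTranspose,
    Matrix.mem_unitaryGroup_iff'.1 hU, Matrix.one_kronecker_one]

theorem trace_replicaConj (X : Matrix (ι × ι) (ι × ι) ℂ) {U : Matrix ι ι ℂ}
    (hU : U ∈ Matrix.unitaryGroup ι ℂ) : (replicaConj X U).trace = X.trace := by
  rw [replicaConj, Matrix.trace_mul_comm, ← mul_assoc, kronecker_conjTranspose_mul_self hU,
    one_mul]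

theorem swapTrace_replicaConj (X : Matrix (ι × ι) (ι × ι) ℂ) {U : Matrix ι ι ℂ}
    (hU : U ∈ Matrix.unitaryGroup ι ℂ) : swapTrace (replicaConj X U) = swapTrace X := by
  have : (replicaConj X U).submatrix id Prod.swap =
      replicaConj (X.submatrix id Prod.swap) U := by
    have e : ((U ⊗ₖ U)ᴴ).submatrix (Equiv.prodComm ι ι) (Equiv.prodComm ι ι) = (U ⊗ₖ U)ᴴ := by
      ext p q
      simp [mul_comm]
    unfold replicaConj
    nth_rw 2 [← e]
    rw [Matrix.submatrix_mul _ _ id id Prod.swap Function.bijective_id]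
    ext p q
    simp only [Matrix.mul_apply, Matrix.submatrix_apply, id, Equiv.prodComm_apply]
    exact (Equiv.sum_comp (Equiv.prodComm ι ι) _).symm
  rw [swapTrace_eq_trace, this, trace_replicaConj _ hU, ← swapTrace_eq_trace]

/-- The Haar average of `(U ⊗ U) X (U ⊗ U)ᴴ`. -/
noncomputable def twirl (μ : Measure (Matrix.unitaryGroup ι ℂ)) (X : Matrix (ι × ι) (ι × ι) ℂ) :
    Matrix (ι × ι) (ι × ι) ℂ :=
  Matrix.of fun p q => ∫ U, replicaConj X (U : Matrix ι ι ℂ) p q ∂μ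

variable (μ : Measure (Matrix.unitaryGroup ι ℂ)) [IsProbabilityMeasure μ]

theorem trace_twirl (X : Matrix (ι × ι) (ι × ι) ℂ) : (twirl μ X).trace = X.trace := by
  simp only [Matrix.trace, Matrix.diag, twirl, Matrix.of_apply]
  rw [← integral_finsetSum _ fun p _ => integrable_replicaConj_apply X μ p p]
  change ∫ U : Matrix.unitaryGroup ι ℂ, (replicaConj X (U : Matrix ι ι ℂ)).trace ∂μ = X.trace
  simp [trace_replicaConj X (Subtype.prop _)]

theorem swapTrace_twirl (X : Matrix (ι × ι) (ι × ι) ℂ) :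
    swapTrace (twirl μ X) = swapTrace X := by
  simp only [swapTrace, twirl, Matrix.of_apply]
  rw [← integral_finsetSum _ fun p _ => integrable_replicaConj_apply X μ p p.swap]
  change ∫ U : Matrix.unitaryGroup ι ℂ, swapTrace (replicaConj X (U : Matrix ι ι ℂ)) ∂μ =
    swapTrace X
  simp [swapTrace_replicaConj X (Subtype.prop _)]

theorem twirl_commute [μ.IsMulLeftInvariant] (X : Matrix (ι × ι) (ι × ι) ℂ) (V : Matrix ι ι ℂ)
    (hV : V ∈ Matrix.unitaryGroup ι ℂ) : (V ⊗ₖ V) * twirl μ X = twirl μ X * (V ⊗ₖ V) := by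
  have : (V ⊗ₖ V) * twirl μ X * (V ⊗ₖ V)ᴴ = twirl μ X := by
    ext p q
    rw [twirl, ← integral_mul_mul_apply (integrable_replicaConj_apply X μ), Matrix.of_apply,
      ← integral_mul_left_eq_self
        (fun U : Matrix.unitaryGroup ι ℂ => replicaConj X (U : Matrix ι ι ℂ) p q) ⟨V, hV⟩]
    refine integral_congr_ae (.of_forall fun U => ?_)
    simp only [replicaConj, Matrix.UnitaryGroup.mul_val, Matrix.mul_kronecker_mul,
      Matrix.conjTranspose_mul, mul_assoc]
  conv_rhs => rw [← this]
  rw [mul_assoc, kronecker_conjTranspose_mul_self hV, mul_one]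

end Twirl

section Channel

variable {d D : ℕ}

/-- `𝟙 ⊗ Y` on two replicas of `ℂ^d ⊗ ℂ^D`, for `Y` on two replicas of `ℂ^D`. -/
def bathLift (d : ℕ) (Y : Matrix (Fin D × Fin D) (Fin D × Fin D) ℂ) :
    Matrix ((Fin d × Fin D) × (Fin d × Fin D)) ((Fin d × Fin D) × (Fin d × Fin D)) ℂ :=
  fun p q => if p.1.1 = q.1.1 ∧ p.2.1 = q.2.1 then Y (p.1.2, p.2.2) (q.1.2, q.2.2) else 0

/-- The partial trace over both copies of `ℂ^d`. -/
def bathTrace (Z : Matrix ((Fin d × Fin D) × (Fin d × Fin D))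
      ((Fin d × Fin D) × (Fin d × Fin D)) ℂ) :
    Matrix (Fin D × Fin D) (Fin D × Fin D) ℂ :=
  fun p q => ∑ s : Fin d, ∑ r : Fin d, Z ((s, p.1), (r, p.2)) ((s, q.1), (r, q.2))

/-- One time step of the two-replica bath evolution, all legs of `ℂ^d` being contracted. -/
def bathStep (U : Matrix (Fin d × Fin D) (Fin d × Fin D) ℂ)
    (Y : Matrix (Fin D × Fin D) (Fin D × Fin D) ℂ) :
    Matrix (Fin D × Fin D) (Fin D × Fin D) ℂ :=
  ∑ x : Fin d × Fin d, ∑ y : Fin d × Fin d,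
    (blockM U x.2 x.1 ⊗ₖ blockM U y.2 y.1) * Y * (blockM U x.2 x.1 ⊗ₖ blockM U y.2 y.1)ᴴ

theorem trace_bathTrace (Z : Matrix ((Fin d × Fin D) × (Fin d × Fin D))
      ((Fin d × Fin D) × (Fin d × Fin D)) ℂ) : (bathTrace Z).trace = Z.trace := by
  simp only [Matrix.trace, Matrix.diag, bathTrace, Fintype.sum_prod_type]
  simp_rw [Finset.sum_comm (s := (Finset.univ : Finset (Fin D))) (t := (Finset.univ : Finset (Fin d)))]

theorem trace_bathLift (Y : Matrix (Fin D × Fin D) (Fin D × Fin D) ℂ) :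
    (bathLift d Y).trace = d ^ 2 * Y.trace := by
  simp only [Matrix.trace, Matrix.diag, bathLift, Fintype.sum_prod_type]
  simp [← Finset.mul_sum]
  ring

theorem swapTrace_bathLift (Y : Matrix (Fin D × Fin D) (Fin D × Fin D) ℂ) :
    swapTrace (bathLift d Y) = d * swapTrace Y := by
  simp only [swapTrace, bathLift, Fintype.sum_prod_type, Prod.swap_prod_mk]
  have : ∀ r s : Fin d, (r = s ∧ s = r) ↔ r = s := fun r s => ⟨And.left, fun h => ⟨h, h.symm⟩⟩
  simp_rw [this, Finset.sum_comm (s := (Finset.univ : Finset (Fin D)))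
    (t := (Finset.univ : Finset (Fin d)))]
  simp

theorem mul_bathLift_apply {m : Type*} (A : Matrix m ((Fin d × Fin D) × (Fin d × Fin D)) ℂ)
    (Y : Matrix (Fin D × Fin D) (Fin D × Fin D) ℂ) (p : m) (r s : Fin d) (b c : Fin D) :
    (A * bathLift d Y) p ((r, b), (s, c)) =
      ∑ a, ∑ e, A p ((r, a), (s, e)) * Y (a, e) (b, c) := by
  simp only [Matrix.mul_apply, bathLift, Fintype.sum_prod_type]
  simp_rw [Finset.sum_comm (s := (Finset.univ : Finset (Fin D)))
    (t := (Finset.univ : Finset (Fin d)))]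
  simp only [ite_and, mul_ite, mul_zero]
  rw [Finset.sum_eq_single r (fun x _ hx => by simp [hx]) (by simp),
    Finset.sum_eq_single s (fun x _ hx => by simp [hx]) (by simp)]
  simp

theorem bathStep_eq (U : Matrix (Fin d × Fin D) (Fin d × Fin D) ℂ)
    (Y : Matrix (Fin D × Fin D) (Fin D × Fin D) ℂ) :
    bathStep U Y = bathTrace (replicaConj (bathLift d Y) U) := by
  ext p q
  simp only [bathStep, bathTrace, replicaConj, Matrix.sum_apply,
    Matrix.mul_apply (M := _ * _), Matrix.mul_apply (N := Y), Fintype.sum_prod_type,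
    mul_bathLift_apply, Matrix.kroneckerMap_apply, blockM, Matrix.conjTranspose_apply]
  rw [Finset.sum_comm]
  refine Finset.sum_congr rfl fun s _ => ?_
  rw [Finset.sum_congr rfl fun _ _ => Finset.sum_comm, Finset.sum_comm]
  refine Finset.sum_congr rfl fun r _ => Finset.sum_congr rfl fun x _ => ?_
  rw [Finset.sum_comm]

theorem trace_bathStep {U : Matrix (Fin d × Fin D) (Fin d × Fin D) ℂ}
    (hU : U ∈ Matrix.unitaryGroup (Fin d × Fin D) ℂ)
    (Y : Matrix (Fin D × Fin D) (Fin D × Fin D) ℂ) :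
    (bathStep U Y).trace = d ^ 2 * Y.trace := by
  rw [bathStep_eq, trace_bathTrace, trace_replicaConj _ hU, trace_bathLift]

theorem sq_sub_one_ne_zero {d D : ℕ} (hd : 2 ≤ d) (hD : 2 ≤ D) : ((d * D : ℂ)) ^ 2 - 1 ≠ 0 := by
  have : 4 ≤ d * D := by nlinarith
  have : d * D * (d * D) ≠ 1 := by nlinarith
  rw [sub_ne_zero]
  intro e
  apply this
  exact_mod_cast (sq (d * D : ℂ)) ▸ e

theorem integral_swapTrace_bathStep (hd : 2 ≤ d) (hD : 2 ≤ D)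
    (μ : Measure (Matrix.unitaryGroup (Fin d × Fin D) ℂ)) [IsProbabilityMeasure μ]
    [μ.IsMulLeftInvariant] (Y : Matrix (Fin D × Fin D) (Fin D × Fin D) ℂ) :
    ∫ U, swapTrace (bathStep (U : Matrix (Fin d × Fin D) (Fin d × Fin D) ℂ) Y) ∂μ =
      d ^ 2 / ((d * D) ^ 2 - 1) * (D * (d ^ 2 - 1) * Y.trace + (D ^ 2 - 1) * swapTrace Y) := by
  have h₁ : ∫ U, swapTrace (bathStep (U : Matrix (Fin d × Fin D) (Fin d × Fin D) ℂ) Y) ∂μ =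
      swapTrace (bathTrace (twirl μ (bathLift d Y))) := by
    simp only [bathStep_eq, swapTrace, bathTrace, twirl, Matrix.of_apply]
    have hint := integrable_replicaConj_apply (bathLift d Y) μ
    rw [integral_finsetSum _ fun p _ => integrable_finsetSum _ fun s _ =>
      integrable_finsetSum _ fun r _ => hint _ _]
    refine Finset.sum_congr rfl fun p _ => ?_
    rw [integral_finsetSum _ fun s _ => integrable_finsetSum _ fun r _ => hint _ _]
    refine Finset.sum_congr rfl fun s _ => ?_
    rw [integral_finsetSum _ fun r _ => hint _ _]
  have : Nontrivial (Fin d) := Fin.nontrivial_iff_two_le.2 hd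
  have : Nontrivial (Fin D) := Fin.nontrivial_iff_two_le.2 hD
  obtain ⟨a, b, hM⟩ := exists_eq_add_swap_of_commute (twirl_commute μ (bathLift d Y))
  have ht := trace_twirl μ (bathLift d Y)
  have hs := swapTrace_twirl μ (bathLift d Y)
  rw [h₁]
  rw [trace_bathLift] at ht
  rw [swapTrace_bathLift] at hs
  generalize twirl μ (bathLift d Y) = M at hM ht hs
  have et : M.trace = a * (d * D) ^ 2 + b * (d * D) := by
    simp only [Matrix.trace, Matrix.diag, hM, Finset.sum_add_distrib]
    simp [Fintype.sum_prod_type, Prod.ext_iff, ite_and]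
    ring
  have es : swapTrace M = a * (d * D) + b * (d * D) ^ 2 := by
    simp only [swapTrace, hM, Finset.sum_add_distrib]
    simp [Fintype.sum_prod_type, Prod.ext_iff, ite_and]
    ring
  have eb : swapTrace (bathTrace M) = a * (d ^ 2 * D) + b * (d * D ^ 2) := by
    simp only [swapTrace, bathTrace, hM, Finset.sum_add_distrib]
    simp [Fintype.sum_prod_type, Prod.ext_iff, ite_and]
    ring
  have hn := sq_sub_one_ne_zero hd hD
  have hd0 : (d : ℂ) ≠ 0 := by norm_cast; omega
  have hD0 : (D : ℂ) ≠ 0 := by norm_cast; omega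
  rw [eb]
  rw [et] at ht
  rw [es] at hs
  have ha : a * (d * D) * ((d * D : ℂ) ^ 2 - 1) = d ^ 2 * Y.trace * (d * D) - d * swapTrace Y := by
    linear_combination (d * D) * ht - hs
  have hb : b * (d * D) * ((d * D : ℂ) ^ 2 - 1) = d * swapTrace Y * (d * D) - d ^ 2 * Y.trace := by
    linear_combination (d * D) * hs - ht
  rw [div_mul_eq_mul_div, eq_div_iff hn]
  linear_combination d * ha + D * hb

end Channel

section Paths

variable {d D T : ℕ}

/-- The ordered product of blocks along the temporal index `x`. -/
def pathProd (u : Fin T → Matrix.unitaryGroup (Fin d × Fin D) ℂ) (x : Fin T → Fin d × Fin d) :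
    Matrix (Fin D) (Fin D) ℂ :=
  (List.ofFn fun τ =>
    blockM (u τ : Matrix (Fin d × Fin D) (Fin d × Fin D) ℂ) (x τ).2 (x τ).1).reverse.prod

/-- The two-replica bath operator obtained from the swap after `T` time steps. -/
def bathEvolution (u : Fin T → Matrix.unitaryGroup (Fin d × Fin D) ℂ) :
    Matrix (Fin D × Fin D) (Fin D × Fin D) ℂ :=
  ∑ x, ∑ y, (pathProd u x ⊗ₖ pathProd u y) * (1 : Matrix _ _ ℂ).submatrix id Prod.swap *
    (pathProd u x ⊗ₖ pathProd u y)ᴴ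

theorem pathProd_snoc (u : Fin T → Matrix.unitaryGroup (Fin d × Fin D) ℂ)
    (U : Matrix.unitaryGroup (Fin d × Fin D) ℂ) (x : Fin T → Fin d × Fin d) (q : Fin d × Fin d) :
    pathProd (Fin.snoc (α := fun _ => Matrix.unitaryGroup (Fin d × Fin D) ℂ) u U : Fin (T + 1) → _)
        (Fin.snoc (α := fun _ => Fin d × Fin d) x q : Fin (T + 1) → _) =
      blockM (U : Matrix (Fin d × Fin D) (Fin d × Fin D) ℂ) q.2 q.1 * pathProd u x := by
  rw [pathProd, List.ofFn_succ']
  simp [pathProd, -List.ofFn_succ]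

theorem bathEvolution_zero (u : Fin 0 → Matrix.unitaryGroup (Fin d × Fin D) ℂ) :
    bathEvolution u = (1 : Matrix _ _ ℂ).submatrix id Prod.swap := by
  simp [bathEvolution, pathProd]

theorem bathEvolution_snoc (u : Fin T → Matrix.unitaryGroup (Fin d × Fin D) ℂ)
    (U : Matrix.unitaryGroup (Fin d × Fin D) ℂ) :
    bathEvolution
        (Fin.snoc (α := fun _ => Matrix.unitaryGroup (Fin d × Fin D) ℂ) u U : Fin (T + 1) → _) =
      bathStep (U : Matrix (Fin d × Fin D) (Fin d × Fin D) ℂ) (bathEvolution u) := by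
  have hsum : ∀ f : (Fin (T + 1) → Fin d × Fin d) → Matrix (Fin D × Fin D) (Fin D × Fin D) ℂ,
      ∑ x, f x = ∑ q, ∑ x, f (Fin.snoc (α := fun _ => Fin d × Fin d) x q) := fun f => by
    rw [← (Fin.snocEquiv fun _ : Fin (T + 1) => Fin d × Fin d).sum_comp, Fintype.sum_prod_type]
    rfl
  simp only [bathEvolution, bathStep, hsum, pathProd_snoc, Matrix.mul_kronecker_mul,
    Matrix.conjTranspose_mul, Finset.mul_sum, Finset.sum_mul, mul_assoc]
  exact Finset.sum_congr rfl fun _ _ => Finset.sum_comm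

theorem trace_bathEvolution (u : Fin T → Matrix.unitaryGroup (Fin d × Fin D) ℂ) :
    (bathEvolution u).trace = d ^ (2 * T) * D := by
  induction T with
  | zero =>
    rw [bathEvolution_zero]
    simp [Matrix.trace, Matrix.one_apply, Fintype.sum_prod_type, Prod.ext_iff, ite_and]
  | succ T ih =>
    rw [← Fin.snoc_init_self u, bathEvolution_snoc, trace_bathStep (Subtype.prop _), ih]
    ring

theorem continuous_swapTrace_bathEvolution :
    Continuous fun u : Fin T → Matrix.unitaryGroup (Fin d × Fin D) ℂ =>
      swapTrace (bathEvolution u) := by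
  have hblock : ∀ s q, Continuous fun U : Matrix.unitaryGroup (Fin d × Fin D) ℂ =>
      blockM (U : Matrix (Fin d × Fin D) (Fin d × Fin D) ℂ) s q := fun s q =>
    continuous_matrix fun a b => continuous_subtype_val.matrix_elem _ _
  have hkron : ∀ s q r p, Continuous fun U : Matrix.unitaryGroup (Fin d × Fin D) ℂ =>
      blockM (U : Matrix (Fin d × Fin D) (Fin d × Fin D) ℂ) s q ⊗ₖ
        blockM (U : Matrix (Fin d × Fin D) (Fin d × Fin D) ℂ) r p := fun s q r p =>
    continuous_matrix fun a b => ((hblock s q).matrix_elem _ _).mul ((hblock r p).matrix_elem _ _)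
  have hE : Continuous fun u : Fin T → Matrix.unitaryGroup (Fin d × Fin D) ℂ =>
      bathEvolution u := by
    induction T with
    | zero => simpa only [bathEvolution_zero] using continuous_const
    | succ T ih =>
      have : (fun u : Fin (T + 1) → Matrix.unitaryGroup (Fin d × Fin D) ℂ => bathEvolution u) =
          fun u => bathStep (u (Fin.last T) : Matrix (Fin d × Fin D) (Fin d × Fin D) ℂ)
            (bathEvolution (Fin.init u)) := by
        funext u
        rw [← bathEvolution_snoc, Fin.snoc_init_self]
      rw [this]
      have hinit : Continuous fun u : Fin (T + 1) → Matrix.unitaryGroup (Fin d × Fin D) ℂ =>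
          bathEvolution (Fin.init u) := ih.comp (continuous_pi fun i => continuous_apply _)
      refine continuous_finsetSum _ fun x _ => continuous_finsetSum _ fun y _ => ?_
      have := (hkron x.2 x.1 y.2 y.1).comp
        (continuous_apply (A := fun _ => Matrix.unitaryGroup (Fin d × Fin D) ℂ) (Fin.last T))
      exact (this.matrix_mul hinit).matrix_mul this.matrix_conjTranspose
  exact continuous_finsetSum _ fun p _ => hE.matrix_elem _ _

theorem integral_swapTrace_bathEvolution (hd : 2 ≤ d) (hD : 2 ≤ D)
    (μ : Measure (Matrix.unitaryGroup (Fin d × Fin D) ℂ)) [IsProbabilityMeasure μ]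
    [μ.IsMulLeftInvariant] :
    ∫ u : Fin T → Matrix.unitaryGroup (Fin d × Fin D) ℂ, swapTrace (bathEvolution u)
        ∂(Measure.pi fun _ => μ) =
      d ^ (2 * T) * (1 + (D ^ 2 - 1) * ((D ^ 2 - 1) / ((d * D) ^ 2 - 1)) ^ T) := by
  induction T with
  | zero =>
    simp [bathEvolution_zero, swapTrace, Matrix.one_apply]
    ring
  | succ T ih =>
    have hint : Integrable (fun u : Fin (T + 1) → Matrix.unitaryGroup (Fin d × Fin D) ℂ =>
        swapTrace (bathEvolution u)) (Measure.pi fun _ => μ) :=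
      integrable_of_continuous continuous_swapTrace_bathEvolution
    have hmp := (measurePreserving_piFinSuccAbove
      (fun _ : Fin (T + 1) => μ) (Fin.last T)).symm
    rw [← hmp.integral_comp', integral_prod_symm]
    · have hsnoc : ∀ (U : Matrix.unitaryGroup (Fin d × Fin D) ℂ)
          (u : Fin T → Matrix.unitaryGroup (Fin d × Fin D) ℂ),
          (MeasurableEquiv.piFinSuccAbove
            (fun _ : Fin (T + 1) => Matrix.unitaryGroup (Fin d × Fin D) ℂ)
            (Fin.last T)).symm (U, u) =
          Fin.snoc (α := fun _ => Matrix.unitaryGroup (Fin d × Fin D) ℂ) u U := fun U u => by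
        rw [MeasurableEquiv.piFinSuccAbove_symm_apply]
        exact Fin.insertNth_last' _ _
      simp only [hsnoc, bathEvolution_snoc, integral_swapTrace_bathStep hd hD,
        trace_bathEvolution]
      rw [integral_const_mul, integral_add (integrable_const _) (Integrable.const_mul
        (integrable_of_continuous continuous_swapTrace_bathEvolution) _)]
      simp only [integral_const_mul, integral_const, probReal_univ, one_smul, ih]
      have hn : ((d * D : ℂ)) ^ 2 - 1 ≠ 0 := sq_sub_one_ne_zero hd hD
      rw [pow_succ (_ / _) T]
      generalize (((D : ℂ) ^ 2 - 1) / ((d * D) ^ 2 - 1)) ^ T = g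
      simp only [div_eq_mul_inv]
      linear_combination (d : ℂ) ^ (2 * (T + 1)) * mul_inv_cancel₀ hn
    · exact (hmp.integrable_comp_emb (MeasurableEquiv.measurableEmbedding _)).2 hint

theorem swapTrace_kronecker_swap (A B : Matrix (Fin D) (Fin D) ℂ) :
    swapTrace ((A ⊗ₖ B) * (1 : Matrix _ _ ℂ).submatrix id Prod.swap * (A ⊗ₖ B)ᴴ) =
      (A * Bᴴ).trace * (B * Aᴴ).trace := by
  have hsw : ∀ p q : Fin D × Fin D, ((A ⊗ₖ B) *
      (1 : Matrix (Fin D × Fin D) (Fin D × Fin D) ℂ).submatrix id Prod.swap) p q =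
      (A ⊗ₖ B) p q.swap := fun p q => by
    simp [Matrix.mul_apply (M := A ⊗ₖ B), Matrix.one_apply]
  simp only [swapTrace, Matrix.mul_apply (N := (A ⊗ₖ B)ᴴ), hsw, Matrix.trace, Matrix.diag,
    Matrix.mul_apply (M := A), Matrix.mul_apply (M := B), Fintype.sum_prod_type,
    Matrix.conjTranspose_apply, Matrix.kroneckerMap_apply, Prod.swap_prod_mk, star_mul',
    Finset.sum_mul_sum]
  refine Finset.sum_congr rfl fun a _ => Finset.sum_congr rfl fun b _ => ?_
  rw [Finset.sum_comm]
  exact Finset.sum_congr rfl fun _ _ => Finset.sum_congr rfl fun _ _ => by ring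

theorem trace_influenceState_mul_self (u : Fin T → Matrix.unitaryGroup (Fin d × Fin D) ℂ) :
    (influenceState u ((D : ℂ)⁻¹ • (1 : Matrix (Fin D) (Fin D) ℂ)) *
      influenceState u ((D : ℂ)⁻¹ • (1 : Matrix (Fin D) (Fin D) ℂ))).trace =
      ((d : ℂ) ^ (2 * T) * D ^ 2)⁻¹ * swapTrace (bathEvolution u) := by
  have h : ∀ x y, influenceState u ((D : ℂ)⁻¹ • (1 : Matrix (Fin D) (Fin D) ℂ)) x y =
      ((d : ℂ) ^ T)⁻¹ * (D : ℂ)⁻¹ * (pathProd u x * (pathProd u y)ᴴ).trace := fun x y => by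
    rw [mul_assoc, ← smul_eq_mul (D : ℂ)⁻¹, ← Matrix.trace_smul]
    simp [influenceState, pathProd]
  have hs : swapTrace (bathEvolution u) = ∑ x, ∑ y, swapTrace ((pathProd u x ⊗ₖ pathProd u y) *
      (1 : Matrix _ _ ℂ).submatrix id Prod.swap * (pathProd u x ⊗ₖ pathProd u y)ᴴ) := by
    simp only [swapTrace, bathEvolution, Matrix.sum_apply]
    rw [Finset.sum_comm]
    exact Finset.sum_congr rfl fun _ _ => Finset.sum_comm
  rw [Matrix.trace]
  simp only [hs, swapTrace_kronecker_swap, Finset.mul_sum, Matrix.diag,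
    Matrix.mul_apply (M := influenceState _ _), h]
  refine Finset.sum_congr rfl fun x _ => Finset.sum_congr rfl fun y _ => ?_
  rw [mul_comm 2 T, pow_mul, mul_inv, ← inv_pow, ← inv_pow]
  ring

end Paths

/-- For `T` independent Haar-random unitaries on `ℂ^d ⊗ ℂ^D` and maximally
mixed initial bath state `ρ_B = 𝟙_D / D`, the Haar-expected purity of the
influence-matrix state satisfies `E[tr(ρ_I²)] ≤ d^{−2T} + 1/D²`. -/
theorem haar_expected_purity_mixed_bath
    (d D T : ℕ) (hd : 2 ≤ d) (hD : 2 ≤ D) (hT : 1 ≤ T)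
    (μ : Measure (Matrix.unitaryGroup (Fin d × Fin D) ℂ))
    [IsProbabilityMeasure μ] [μ.IsHaarMeasure] :
    (∫ u : Fin T → Matrix.unitaryGroup (Fin d × Fin D) ℂ,
        ((influenceState u (((D : ℂ))⁻¹ • (1 : Matrix (Fin D) (Fin D) ℂ)) *
            influenceState u (((D : ℂ))⁻¹ • (1 : Matrix (Fin D) (Fin D) ℂ))).trace).re
        ∂(Measure.pi fun _ : Fin T => μ)) ≤
      ((d : ℝ) ^ (2 * T))⁻¹ + 1 / (D : ℝ) ^ 2 := by
  simp only [trace_influenceState_mul_self]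
  have hint : Integrable (fun u : Fin T → Matrix.unitaryGroup (Fin d × Fin D) ℂ =>
      ((d : ℂ) ^ (2 * T) * D ^ 2)⁻¹ * swapTrace (bathEvolution u)) (Measure.pi fun _ => μ) :=
    (integrable_of_continuous continuous_swapTrace_bathEvolution).const_mul _
  have hre := integral_re hint
  simp only [RCLike.re_eq_complex_re] at hre
  rw [hre, integral_const_mul, integral_swapTrace_bathEvolution hd hD]
  have hd' : (2 : ℝ) ≤ d := by exact_mod_cast hd
  have hD' : (2 : ℝ) ≤ D := by exact_mod_cast hD
  have hcast : ((d : ℂ) ^ (2 * T) * D ^ 2)⁻¹ *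
      (d ^ (2 * T) * (1 + (D ^ 2 - 1) * ((D ^ 2 - 1) / ((d * D) ^ 2 - 1)) ^ T)) =
      (((d : ℝ) ^ (2 * T) * D ^ 2)⁻¹ *
      (d ^ (2 * T) * (1 + (D ^ 2 - 1) * ((D ^ 2 - 1) / ((d * D) ^ 2 - 1)) ^ T)) : ℝ) := by
    push_cast
    rfl
  rw [hcast, Complex.ofReal_re]
  have hn : (0 : ℝ) < (d * D) ^ 2 - 1 := by nlinarith [mul_le_mul hd' hD' (by norm_num) (by linarith)]
  have hγ₀ : 0 ≤ ((D : ℝ) ^ 2 - 1) / ((d * D) ^ 2 - 1) := div_nonneg (by nlinarith) hn.le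
  have hγ : ((D : ℝ) ^ 2 - 1) / ((d * D) ^ 2 - 1) ≤ ((d : ℝ) ^ 2)⁻¹ := by
    rw [div_le_iff₀ hn, inv_mul_eq_div, le_div_iff₀ (by positivity)]
    nlinarith
  have hγT := pow_le_pow_left₀ hγ₀ hγ T
  rw [inv_pow, ← pow_mul] at hγT
  have hle : ((D : ℝ) ^ 2 - 1) * (((D : ℝ) ^ 2 - 1) / ((d * D) ^ 2 - 1)) ^ T ≤
      D ^ 2 * ((d : ℝ) ^ (2 * T))⁻¹ :=
    mul_le_mul (by linarith) hγT (pow_nonneg hγ₀ T) (by positivity)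
  calc ((d : ℝ) ^ (2 * T) * D ^ 2)⁻¹ *
        (d ^ (2 * T) * (1 + (D ^ 2 - 1) * ((D ^ 2 - 1) / ((d * D) ^ 2 - 1)) ^ T))
      ≤ ((d : ℝ) ^ (2 * T) * D ^ 2)⁻¹ *
        (d ^ (2 * T) * (1 + D ^ 2 * ((d : ℝ) ^ (2 * T))⁻¹)) := by gcongr
    _ = ((d : ℝ) ^ (2 * T))⁻¹ + 1 / (D : ℝ) ^ 2 := by
      field_simp
      ring
end
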